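/- Convergence of the weighted splitting with spatial and rational temporal discretization: Let X, X_m, P_m, J_m form an approximation scheme, let A, A_m and B, B_m each be stable and consistent approximating families of operators, and suppose A and B generate strongly continuous semigroups on X and that the closure of A + B (with domain containing D(A) ∩ D(B)) generates a strongly continuous semigroup (U(t))_{t≥0} on X. Let r and q be rational functions with r(0) = r'(0) = 1, q(0) = q'(0) = 1, bounded on ℂ₋, with r(hA_m), q(hB_m) defined via partial fraction decompositions. Fix Θ ∈ [0,1] and suppose there exist M ≥ 1 and ω ∈ ℝ such that ‖[ Θ q(h B_m) r(h A_m) + (1 − Θ) r(h A_m) q(h B_m) ]^{k}‖ ≤ M e^{khω} for all h > 0 and all k, m ∈ ℕ. Then for every x ∈ X, lim_{m,n→∞} J_m [ Θ q((t/n) B_m) r((t/n) A_m) + (1 − Θ) r((t/n) A_m) q((t/n) B_m) ]^{n} P_m x = U(t)x, uniformly for t in compact intervals of [0,∞). -/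

import Mathlib

open Filter Topology

/-- `R` is the resolvent operator `R(lam, A) = (lam - A)⁻¹` of the (possibly
unbounded) linear operator `A`, given as a partially defined linear map. -/
structure IsResolvent {Y : Type*} [NormedAddCommGroup Y] [NormedSpace ℂ Y]
    (A : Y →ₗ.[ℂ] Y) (lam : ℂ) (R : Y →L[ℂ] Y) : Prop where
  mem : ∀ x : Y, R x ∈ A.domain
  eq_right : ∀ x : Y, lam • R x - A ⟨R x, mem x⟩ = x
  eq_left : ∀ y : A.domain, R (lam • (y : Y) - A y) = (y : Y)

/-- The operator `r(h A)` where the rational function `r` is given through its partial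
fraction decomposition `r(z) = Σ_{i,j} C i j • (1 - z/lam i)⁻ʲ` and the operator `A`
through its resolvent family `R`:  `r(h A) = Σ_{i,j} C i j • [(lam i/h) R(lam i/h, A)]ʲ`.
(For `h ≤ 0` it is defined to be the identity, corresponding to `r(0·A) = I`.) -/
noncomputable def ratOp {Y : Type*} [NormedAddCommGroup Y] [NormedSpace ℂ Y]
    (l : ℕ) (ν : Fin l → ℕ) (lam : Fin l → ℂ) (C : Fin l → ℕ → ℂ)
    (R : ℂ → Y →L[ℂ] Y) (h : ℝ) : Y →L[ℂ] Y :=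
  if h ≤ 0 then 1 else
    ∑ i, ∑ j ∈ Finset.Icc 1 (ν i), C i j • ((lam i / (h : ℂ)) • R (lam i / (h : ℂ))) ^ j

/-- The rational function `r(z) = Σ_{i,j} C i j (1 - z/lam i)⁻ʲ` given by a partial
fraction decomposition. -/
noncomputable def pfdFun (l : ℕ) (ν : Fin l → ℕ) (lam : Fin l → ℂ) (C : Fin l → ℕ → ℂ)
    (z : ℂ) : ℂ :=
  ∑ i, ∑ j ∈ Finset.Icc 1 (ν i), C i j * (1 - z / lam i) ^ (-(j : ℤ))

/-- `(T t)_{t ≥ 0}` is a strongly continuous semigroup of bounded linear operators. -/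
def IsC0Semigroup {Y : Type*} [NormedAddCommGroup Y] [NormedSpace ℂ Y]
    (T : ℝ → Y →L[ℂ] Y) : Prop :=
  T 0 = 1 ∧ (∀ s t : ℝ, 0 ≤ s → 0 ≤ t → T (s + t) = T s * T t) ∧
    ∀ x : Y, ContinuousOn (fun t : ℝ => T t x) (Set.Ici 0)

/-- The graph of the generator of a semigroup `T`: pairs `(x, y)` such that
`(T h x - x)/h → y` as `h → 0+`. -/
def generatorGraph {Y : Type*} [NormedAddCommGroup Y] [NormedSpace ℂ Y]
    (T : ℝ → Y →L[ℂ] Y) : Set (Y × Y) :=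
  {p | Tendsto (fun h : ℝ => ((h : ℂ))⁻¹ • (T h p.1 - p.1)) (𝓝[>] (0 : ℝ)) (𝓝 p.2)}

/-- The operator `A` generates the strongly continuous semigroup `T`. -/
def IsGenerator {Y : Type*} [NormedAddCommGroup Y] [NormedSpace ℂ Y]
    (A : Y →ₗ.[ℂ] Y) (T : ℝ → Y →L[ℂ] Y) : Prop :=
  IsC0Semigroup T ∧ (A.graph : Set (Y × Y)) = generatorGraph T

/-! ### Null families -/

/-- A family of vectors, in spaces depending on the index, whose norms tend to zero along `l`. -/
def IsNull {ι : Type*} (l : Filter ι) {E : ι → Type*} [∀ i, NormedAddCommGroup (E i)]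
    (f : ∀ i, E i) : Prop :=
  Tendsto (fun i => ‖f i‖) l (𝓝 0)

namespace IsNull

variable {ι : Type*} {l : Filter ι} {E : ι → Type*} [∀ i, NormedAddCommGroup (E i)]

theorem congr' {f g : ∀ i, E i} (hf : IsNull l f) (h : ∀ᶠ i in l, f i = g i) : IsNull l g :=
  Tendsto.congr' (h.mono fun i hi => by simp only [hi]) hf

theorem add {f g : ∀ i, E i} (hf : IsNull l f) (hg : IsNull l g) :
    IsNull l fun i => f i + g i := by
  refine squeeze_zero (fun i => norm_nonneg _) (fun i => norm_add_le (f i) (g i)) ?_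
  simpa using Tendsto.add hf hg

theorem zero : IsNull l fun i => (0 : E i) := by
  simpa [IsNull] using tendsto_const_nhds

theorem sum {κ : Type*} (s : Finset κ) {f : κ → ∀ i, E i} (h : ∀ k ∈ s, IsNull l (f k)) :
    IsNull l fun i => ∑ k ∈ s, f k i := by
  classical
  induction s using Finset.induction_on with
  | empty => simpa using zero
  | insert a s ha ih =>
    have h1 := (h a (Finset.mem_insert_self a s)).add
      (ih fun k hk => h k (Finset.mem_insert_of_mem hk))
    exact h1.congr' (Eventually.of_forall fun i =>
      (Finset.sum_insert (f := fun k => f k i) ha).symm)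

variable [∀ i, NormedSpace ℂ (E i)]

theorem smul (c : ℂ) {f : ∀ i, E i} (hf : IsNull l f) : IsNull l fun i => c • f i := by
  have := Tendsto.const_mul ‖c‖ hf
  simpa [IsNull, norm_smul] using this

theorem apply {C : ℝ} {T : ∀ i, E i →L[ℂ] E i} (hT : ∀ᶠ i in l, ‖T i‖ ≤ C) {f : ∀ i, E i}
    (hf : IsNull l f) : IsNull l fun i => T i (f i) := by
  refine squeeze_zero' (Eventually.of_forall fun i => norm_nonneg _)
    (hT.mono fun i hi => (T i).le_of_opNorm_le hi (f i)) ?_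
  simpa using Tendsto.const_mul C hf

theorem pow_sub {C : ℝ} {S : ∀ i, E i →L[ℂ] E i} (hS : ∀ᶠ i in l, ‖S i‖ ≤ C) {z : ∀ i, E i}
    (hz : IsNull l fun i => S i (z i) - z i) (j : ℕ) :
    IsNull l fun i => (S i ^ j) (z i) - z i := by
  induction j with
  | zero => simpa using zero
  | succ j ih =>
    refine ((ih.apply hS).add hz).congr' (Eventually.of_forall fun i => ?_)
    rw [pow_succ', mul_apply_eq_comp, map_sub]
    abel

theorem pow_quotient_sub {C : ℝ} {S : ∀ i, E i →L[ℂ] E i} (hS : ∀ᶠ i in l, ‖S i‖ ≤ C)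
    {z w : ∀ i, E i} {a : ι → ℂ} {c : ℂ} (hz : IsNull l fun i => S i (z i) - z i)
    (hw : IsNull l fun i => (a i)⁻¹ • (S i (w i) - w i) - c • z i) (j : ℕ) :
    IsNull l fun i => (a i)⁻¹ • ((S i ^ j) (w i) - w i) - (j * c) • z i := by
  induction j with
  | zero => simpa using zero
  | succ j ih =>
    refine (((ih.apply hS).add (hz.smul (j * c))).add hw).congr'
      (Eventually.of_forall fun i => ?_)
    simp only [pow_succ', mul_apply_eq_comp, map_sub, map_smul, Nat.cast_add,
      Nat.cast_one]
    module

/-- A uniformly bounded family of operators that is null on a dense set is null everywhere. -/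
theorem of_dense {X : Type*} [NormedAddCommGroup X] [NormedSpace ℂ X] {C : ℝ}
    {T : ∀ i, X →L[ℂ] E i} (hT : ∀ᶠ i in l, ‖T i‖ ≤ C) {s : Set X} (hs : Dense s)
    (h : ∀ x ∈ s, IsNull l fun i => T i x) (x : X) : IsNull l fun i => T i x := by
  refine Metric.tendsto_nhds.2 fun ε hε => ?_
  have hC : 0 < |C| + 1 := by positivity
  obtain ⟨y, hy, hxy⟩ := Metric.dense_iff.1 hs x (ε / 2 / (|C| + 1)) (by positivity)
  filter_upwards [hT, (Metric.tendsto_nhds.1 (h y hxy)) (ε / 2) (by positivity)] with i h1 h2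
  simp only [dist_zero_right, norm_norm] at h2 ⊢
  have h3 : ‖T i (x - y)‖ ≤ (|C| + 1) * ‖x - y‖ :=
    (T i).le_of_opNorm_le (h1.trans ((le_abs_self C).trans (by linarith))) _
  have h4 : ‖x - y‖ < ε / 2 / (|C| + 1) := by
    rw [← dist_eq_norm, dist_comm]; exact hy
  have h5 : (|C| + 1) * ‖x - y‖ < ε / 2 := by
    rw [lt_div_iff₀ hC] at h4; linarith
  calc ‖T i x‖ = ‖T i (x - y) + T i y‖ := by rw [← map_add]; simp
    _ ≤ ‖T i (x - y)‖ + ‖T i y‖ := norm_add_le _ _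
    _ < ε := by linarith

end IsNull

/-! ### Rational functions of operators -/

theorem pfdFun_zero (l : ℕ) (ν : Fin l → ℕ) (lam : Fin l → ℂ) (C : Fin l → ℕ → ℂ) :
    pfdFun l ν lam C 0 = ∑ i, ∑ j ∈ Finset.Icc 1 (ν i), C i j := by
  simp [pfdFun]

theorem hasDerivAt_pfdFun_zero (l : ℕ) (ν : Fin l → ℕ) (lam : Fin l → ℂ)
    (C : Fin l → ℕ → ℂ) :
    HasDerivAt (pfdFun l ν lam C)
      (∑ i, ∑ j ∈ Finset.Icc 1 (ν i), C i j * (j * (lam i)⁻¹)) 0 := by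
  unfold pfdFun
  refine HasDerivAt.fun_sum fun i _ => HasDerivAt.fun_sum fun j _ => HasDerivAt.const_mul _ ?_
  have h1 : HasDerivAt (fun z : ℂ => 1 - z / lam i) (-(1 / lam i)) 0 :=
    ((hasDerivAt_id (0 : ℂ)).div_const _).const_sub 1
  have h2 := (hasDerivAt_zpow (-(j : ℤ)) ((1 : ℂ) - 0 / lam i) (Or.inl (by simp))).comp 0 h1
  have h3 : ((-(j : ℤ) : ℤ) : ℂ) * (1 - 0 / lam i) ^ (-(j : ℤ) - 1) * -(1 / lam i) =
      j * (lam i)⁻¹ := by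
    simp
  rwa [h3] at h2

theorem IsResolvent.smul_sub_self {Y : Type*} [NormedAddCommGroup Y] [NormedSpace ℂ Y]
    {A : Y →ₗ.[ℂ] Y} {μ : ℂ} {R : Y →L[ℂ] Y} (h : IsResolvent A μ R) (y : A.domain) :
    μ • R y - y = R (A y) := by
  have h1 := h.eq_left y
  rw [map_sub, map_smul] at h1
  rw [sub_eq_iff_eq_add] at h1 ⊢
  rw [h1, add_comm]

theorem norm_scaled_resolvent_le {Y : Type*} [NormedAddCommGroup Y] [NormedSpace ℂ Y]
    {R : ℂ → Y →L[ℂ] Y} {M : ℝ} (hR : ∀ μ : ℂ, 0 < μ.re → μ.re * ‖R μ‖ ≤ M)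
    {lam : ℂ} (hlam : 0 < lam.re) {h : ℝ} (hh : 0 < h) :
    ‖(lam / (h : ℂ)) • R (lam / (h : ℂ))‖ ≤ ‖lam‖ * M / lam.re := by
  have hre : (lam / (h : ℂ)).re = lam.re / h := Complex.div_ofReal_re _ _
  have h1 := hR (lam / (h : ℂ)) (by rw [hre]; positivity)
  rw [hre] at h1
  rw [norm_smul, norm_div, Complex.norm_real, Real.norm_of_nonneg hh.le, le_div_iff₀ hlam]
  calc ‖lam‖ / h * ‖R (lam / (h : ℂ))‖ * lam.re
      = ‖lam‖ * (lam.re / h * ‖R (lam / (h : ℂ))‖) := by ring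
    _ ≤ ‖lam‖ * M := by gcongr

theorem norm_ratOp_le {Y : Type*} [NormedAddCommGroup Y] [NormedSpace ℂ Y]
    {R : ℂ → Y →L[ℂ] Y} {M : ℝ} (hR : ∀ μ : ℂ, 0 < μ.re → μ.re * ‖R μ‖ ≤ M)
    (l : ℕ) (ν : Fin l → ℕ) {lam : Fin l → ℂ} (hlam : ∀ i, 0 < (lam i).re)
    (C : Fin l → ℕ → ℂ) {h : ℝ} (hh : 0 < h) :
    ‖ratOp l ν lam C R h‖ ≤
      ∑ i, ∑ j ∈ Finset.Icc 1 (ν i), ‖C i j‖ * (‖lam i‖ * M / (lam i).re) ^ j := by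
  rw [ratOp, if_neg hh.not_ge]
  refine norm_sum_le_of_le _ fun i _ => norm_sum_le_of_le _ fun j hj => ?_
  rw [norm_smul]
  gcongr
  refine (norm_pow_le' _ (Finset.mem_Icc.1 hj).1).trans ?_
  gcongr
  exact norm_scaled_resolvent_le hR (hlam i) hh

section Consistency

variable {X : Type*} [NormedAddCommGroup X] [NormedSpace ℂ X]
  {Xm : ℕ → Type*} [∀ m, NormedAddCommGroup (Xm m)] [∀ m, NormedSpace ℂ (Xm m)]
  {P : ∀ m, X →L[ℂ] Xm m} {J : ∀ m, Xm m →L[ℂ] X} {K : ℝ}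
  {A : X →ₗ.[ℂ] X} {Am : ∀ m, Xm m →ₗ.[ℂ] Xm m}
  {RAm : ∀ m, ℂ → Xm m →L[ℂ] Xm m} {M : ℝ}

/-- The filter of pairs `(m, h)` with `m → ∞` and `h → 0+`. -/
def discretizationFilter : Filter (ℕ × ℝ) := atTop ×ˢ 𝓝[>] (0 : ℝ)

theorem eventually_pos_discretizationFilter : ∀ᶠ p in discretizationFilter, 0 < p.2 :=
  tendsto_snd.eventually self_mem_nhdsWithin

theorem isNull_generator_sub (hPJ : ∀ m (y : Xm m), P m (J m y) = y) (hP : ∀ m, ‖P m‖ ≤ K)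
    (hdom : ∀ m, ∀ x ∈ A.domain, P m x ∈ (Am m).domain)
    (hcons : ∀ x : A.domain,
      Tendsto (fun m => J m ((Am m) ⟨P m (x : X), hdom m x x.2⟩)) atTop (𝓝 (A x)))
    (x : A.domain) :
    IsNull discretizationFilter fun p : ℕ × ℝ =>
      Am p.1 ⟨P p.1 (x : X), hdom p.1 x x.2⟩ - P p.1 (A x) := by
  have h1 : Tendsto (fun m => K * ‖J m (Am m ⟨P m (x : X), hdom m x x.2⟩) - A x‖) atTop
      (𝓝 0) := by
    simpa using (tendsto_iff_norm_sub_tendsto_zero.1 (hcons x)).const_mul K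
  refine squeeze_zero (fun p => norm_nonneg _) (fun p => ?_)
    (h1.comp (tendsto_fst : Tendsto _ discretizationFilter _))
  have h2 := (P p.1).le_of_opNorm_le (hP p.1)
    (J p.1 (Am p.1 ⟨P p.1 (x : X), hdom p.1 x x.2⟩) - A x)
  rwa [map_sub, hPJ] at h2

theorem isNull_scaled_resolvent_sub (hPJ : ∀ m (y : Xm m), P m (J m y) = y)
    (hP : ∀ m, ‖P m‖ ≤ K) (hdense : Dense (A.domain : Set X))
    (hres : ∀ m, ∀ μ : ℂ, 0 < μ.re → IsResolvent (Am m) μ (RAm m μ) ∧ μ.re * ‖RAm m μ‖ ≤ M)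
    (hdom : ∀ m, ∀ x ∈ A.domain, P m x ∈ (Am m).domain)
    (hcons : ∀ x : A.domain,
      Tendsto (fun m => J m ((Am m) ⟨P m (x : X), hdom m x x.2⟩)) atTop (𝓝 (A x)))
    {lam : ℂ} (hlam : 0 < lam.re) (y : X) :
    IsNull discretizationFilter fun p : ℕ × ℝ =>
      ((lam / (p.2 : ℂ)) • RAm p.1 (lam / (p.2 : ℂ))) (P p.1 y) - P p.1 y := by
  have hS : ∀ᶠ p : ℕ × ℝ in discretizationFilter,
      ‖(lam / (p.2 : ℂ)) • RAm p.1 (lam / (p.2 : ℂ))‖ ≤ ‖lam‖ * M / lam.re :=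
    eventually_pos_discretizationFilter.mono fun p hp =>
      norm_scaled_resolvent_le (fun μ hμ => (hres p.1 μ hμ).2) hlam hp
  refine IsNull.of_dense (C := ‖lam‖ * M / lam.re * K + K)
    (T := fun p : ℕ × ℝ =>
      ((lam / (p.2 : ℂ)) • RAm p.1 (lam / (p.2 : ℂ))) ∘L P p.1 - P p.1) ?_ hdense ?_ y
  · filter_upwards [hS] with p hp
    refine (norm_sub_le _ _).trans (add_le_add ?_ (hP _))
    refine (ContinuousLinearMap.opNorm_comp_le _ _).trans ?_
    exact mul_le_mul hp (hP _) (norm_nonneg _) ((norm_nonneg _).trans hp)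
  · intro x hx
    have hh : Tendsto (fun p : ℕ × ℝ => p.2) discretizationFilter (𝓝 0) :=
      tendsto_snd.mono_right nhdsWithin_le_nhds
    have hA := isNull_generator_sub hPJ hP hdom hcons ⟨x, hx⟩
    have hlim : Tendsto (fun p : ℕ × ℝ => p.2 * ((‖lam‖ * M / lam.re) * ‖lam‖⁻¹ *
        (‖Am p.1 ⟨P p.1 x, hdom p.1 x hx⟩ - P p.1 (A ⟨x, hx⟩)‖ + K * ‖A ⟨x, hx⟩‖)))
        discretizationFilter (𝓝 0) := by
      simpa using hh.mul ((Tendsto.add_const (K * ‖A ⟨x, hx⟩‖) hA).const_mul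
        ((‖lam‖ * M / lam.re) * ‖lam‖⁻¹))
    refine squeeze_zero' (Eventually.of_forall fun p => norm_nonneg _) ?_ hlim
    filter_upwards [eventually_pos_discretizationFilter, hS] with p hp hSp
    have hlam0 : lam ≠ 0 := fun h => by simp [h] at hlam
    have hp0 : (p.2 : ℂ) ≠ 0 := by exact_mod_cast hp.ne'
    have hμ : 0 < (lam / (p.2 : ℂ)).re := by
      rw [Complex.div_ofReal_re]; positivity
    have e1 := (hres p.1 _ hμ).1.smul_sub_self ⟨P p.1 x, hdom p.1 x hx⟩
    have e2 : (((lam / (p.2 : ℂ)) • RAm p.1 (lam / (p.2 : ℂ))) ∘L P p.1 - P p.1) x =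
        ((p.2 : ℂ) / lam) • ((lam / (p.2 : ℂ)) • RAm p.1 (lam / (p.2 : ℂ)))
          (Am p.1 ⟨P p.1 x, hdom p.1 x hx⟩) := by
      rw [smul_apply, ← e1, smul_smul, div_mul_div_cancel₀ hlam0,
        div_self hp0, one_smul]
      rfl
    rw [e2, norm_smul, norm_div, Complex.norm_real, Real.norm_of_nonneg hp.le]
    have e3 : ‖Am p.1 ⟨P p.1 x, hdom p.1 x hx⟩‖ ≤
        ‖Am p.1 ⟨P p.1 x, hdom p.1 x hx⟩ - P p.1 (A ⟨x, hx⟩)‖ + K * ‖A ⟨x, hx⟩‖ :=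
      (norm_le_norm_sub_add _ (P p.1 (A ⟨x, hx⟩))).trans
        (add_le_add_right ((P p.1).le_of_opNorm_le (hP _) _) _)
    have e4 := (ContinuousLinearMap.le_of_opNorm_le _ hSp
      (Am p.1 ⟨P p.1 x, hdom p.1 x hx⟩)).trans
        (mul_le_mul_of_nonneg_left e3 ((norm_nonneg _).trans hSp))
    calc _ ≤ p.2 / ‖lam‖ * (‖lam‖ * M / lam.re * _) :=
          mul_le_mul_of_nonneg_left e4 (by positivity)
      _ = _ := by ring

theorem isNull_ratOp_sub
    (hPJ : ∀ m (y : Xm m), P m (J m y) = y)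
    (hP : ∀ m, ‖P m‖ ≤ K) (hdense : Dense (A.domain : Set X))
    (hres : ∀ m, ∀ μ : ℂ, 0 < μ.re → IsResolvent (Am m) μ (RAm m μ) ∧ μ.re * ‖RAm m μ‖ ≤ M)
    (hdom : ∀ m, ∀ x ∈ A.domain, P m x ∈ (Am m).domain)
    (hcons : ∀ x : A.domain,
      Tendsto (fun m => J m ((Am m) ⟨P m (x : X), hdom m x x.2⟩)) atTop (𝓝 (A x)))
    {l : ℕ} {ν : Fin l → ℕ} {lam : Fin l → ℂ} {C : Fin l → ℕ → ℂ}
    (hlam : ∀ i, 0 < (lam i).re) (h0 : pfdFun l ν lam C 0 = 1)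
    (y : X) :
    IsNull discretizationFilter fun p : ℕ × ℝ =>
      ratOp l ν lam C (RAm p.1) p.2 (P p.1 y) - P p.1 y := by
  have key := IsNull.sum Finset.univ fun i _ => IsNull.sum (Finset.Icc 1 (ν i)) fun j _ =>
    ((isNull_scaled_resolvent_sub hPJ hP hdense hres hdom hcons (hlam i) y).pow_sub
      (eventually_pos_discretizationFilter.mono fun p hp =>
        norm_scaled_resolvent_le (fun μ hμ => (hres p.1 μ hμ).2) (hlam i) hp) j).smul (C i j)
  refine key.congr' (eventually_pos_discretizationFilter.mono fun p hp => ?_)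
  rw [pfdFun_zero] at h0
  simp only [ratOp, if_neg hp.not_ge, smul_sub, Finset.sum_sub_distrib, ← Finset.sum_smul, h0,
    one_smul, sum_apply, smul_apply]

theorem isNull_ratOp_quotient_sub
    (hPJ : ∀ m (y : Xm m), P m (J m y) = y)
    (hP : ∀ m, ‖P m‖ ≤ K) (hdense : Dense (A.domain : Set X))
    (hres : ∀ m, ∀ μ : ℂ, 0 < μ.re → IsResolvent (Am m) μ (RAm m μ) ∧ μ.re * ‖RAm m μ‖ ≤ M)
    (hdom : ∀ m, ∀ x ∈ A.domain, P m x ∈ (Am m).domain)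
    (hcons : ∀ x : A.domain,
      Tendsto (fun m => J m ((Am m) ⟨P m (x : X), hdom m x x.2⟩)) atTop (𝓝 (A x)))
    {l : ℕ} {ν : Fin l → ℕ} {lam : Fin l → ℂ} {C : Fin l → ℕ → ℂ}
    (hlam : ∀ i, 0 < (lam i).re) (h0 : pfdFun l ν lam C 0 = 1)
    (h1 : HasDerivAt (pfdFun l ν lam C) 1 0) (x : A.domain) :
    IsNull discretizationFilter fun p : ℕ × ℝ =>
      (p.2 : ℂ)⁻¹ • (ratOp l ν lam C (RAm p.1) p.2 (P p.1 x) - P p.1 x) - P p.1 (A x) := by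
  have hS : ∀ i, ∀ᶠ p : ℕ × ℝ in discretizationFilter,
      ‖(lam i / (p.2 : ℂ)) • RAm p.1 (lam i / (p.2 : ℂ))‖ ≤ ‖lam i‖ * M / (lam i).re :=
    fun i => eventually_pos_discretizationFilter.mono fun p hp =>
      norm_scaled_resolvent_le (fun μ hμ => (hres p.1 μ hμ).2) (hlam i) hp
  have hz := fun i =>
    isNull_scaled_resolvent_sub hPJ hP hdense hres hdom hcons (hlam i) (A x)
  have hw : ∀ i, IsNull discretizationFilter fun p : ℕ × ℝ => (p.2 : ℂ)⁻¹ •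
      (((lam i / (p.2 : ℂ)) • RAm p.1 (lam i / (p.2 : ℂ))) (P p.1 x) - P p.1 x) -
        (lam i)⁻¹ • P p.1 (A x) := fun i => by
    refine ((((isNull_generator_sub hPJ hP hdom hcons x).apply (hS i)).add (hz i)).smul
      (lam i)⁻¹).congr' (eventually_pos_discretizationFilter.mono fun p hp => ?_)
    have hlam0 : lam i ≠ 0 := fun h => by simpa [h] using hlam i
    have hp0 : (p.2 : ℂ) ≠ 0 := by exact_mod_cast hp.ne'
    have hμ : 0 < (lam i / (p.2 : ℂ)).re := by
      rw [Complex.div_ofReal_re]; exact div_pos (hlam i) hp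
    have e1 := (hres p.1 _ hμ).1.smul_sub_self ⟨P p.1 x, hdom p.1 x x.2⟩
    rw [smul_apply _ _ (P p.1 (x : X)), e1, map_sub, sub_add_sub_cancel,
      smul_sub, smul_apply, smul_smul]
    congr 2
    field_simp
  have key := IsNull.sum Finset.univ fun i _ => IsNull.sum (Finset.Icc 1 (ν i)) fun j _ =>
    (IsNull.pow_quotient_sub (hS i) (hz i) (hw i) j).smul (C i j)
  refine key.congr' (eventually_pos_discretizationFilter.mono fun p hp => ?_)
  have h2 := (hasDerivAt_pfdFun_zero l ν lam C).unique h1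
  rw [pfdFun_zero] at h0
  simp only [ratOp, if_neg hp.not_ge, smul_sub, Finset.sum_sub_distrib, smul_smul,
    ← Finset.sum_smul, h2, one_smul, sum_apply,
    smul_apply]
  simp only [Finset.smul_sum, smul_smul, mul_comm (p.2 : ℂ)⁻¹, ← Finset.sum_mul,
    h0, one_mul]

end Consistency

/-! ### Strongly continuous semigroups -/

namespace IsC0Semigroup

variable {X : Type*} [NormedAddCommGroup X] [NormedSpace ℂ X] {U : ℝ → X →L[ℂ] X}

theorem exists_norm_le [CompleteSpace X] (hU : IsC0Semigroup U) (T : ℝ) :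
    ∃ C, ∀ s ∈ Set.Icc 0 T, ‖U s‖ ≤ C := by
  have h : ∀ x, ∃ C, ∀ s : Set.Icc 0 T, ‖U s x‖ ≤ C := fun x => by
    obtain ⟨C, hC⟩ := isCompact_Icc.exists_bound_of_continuousOn
      ((hU.2.2 x).mono (Set.Icc_subset_Ici_self : Set.Icc 0 T ⊆ _))
    exact ⟨C, fun s => hC s s.2⟩
  obtain ⟨C, hC⟩ := banach_steinhaus h
  exact ⟨C, fun s hs => hC ⟨s, hs⟩⟩

theorem orbit_mem_generatorGraph (hU : IsC0Semigroup U) {x y : X}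
    (hxy : (x, y) ∈ generatorGraph U) {s : ℝ} (hs : 0 ≤ s) :
    (U s x, U s y) ∈ generatorGraph U := by
  refine (((U s).continuous.tendsto y).comp hxy).congr' ?_
  filter_upwards [self_mem_nhdsWithin] with h hh
  simp only [Function.comp_apply, map_smul, map_sub, ← mul_apply_eq_comp]
  rw [← hU.2.1 s h hs (le_of_lt hh), add_comm, hU.2.1 h s (le_of_lt hh) hs]

theorem hasDerivWithinAt_orbit (hU : IsC0Semigroup U) {x y : X}
    (hxy : (x, y) ∈ generatorGraph U) {s : ℝ} (hs : 0 ≤ s) :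
    HasDerivWithinAt (fun t => U t x) (U s y) (Set.Ici s) s := by
  rw [← hasDerivWithinAt_Ioi_iff_Ici, hasDerivWithinAt_iff_tendsto_slope' Set.self_notMem_Ioi]
  have h1 : Tendsto (fun t => t - s) (𝓝[>] s) (𝓝[>] 0) := by
    refine tendsto_nhdsWithin_iff.2 ⟨?_, ?_⟩
    · have : Tendsto (fun t => t - s) (𝓝 s) (𝓝 (s - s)) :=
        Continuous.tendsto (by fun_prop) s
      rw [sub_self] at this
      exact this.mono_left nhdsWithin_le_nhds
    · filter_upwards [self_mem_nhdsWithin] with t ht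
      exact sub_pos.2 (Set.mem_Ioi.1 ht)
  refine ((hU.orbit_mem_generatorGraph hxy hs).comp h1).congr' ?_
  filter_upwards [self_mem_nhdsWithin] with t ht
  have ht : s < t := ht
  rw [Function.comp_apply, slope_def_module, ← mul_apply_eq_comp,
    ← hU.2.1 _ _ (sub_pos.2 ht).le hs, sub_add_cancel, ← Complex.ofReal_inv, Complex.coe_smul]

theorem norm_orbit_sub_le (hU : IsC0Semigroup U) {x y : X} (hxy : (x, y) ∈ generatorGraph U)
    {a b : ℝ} (ha : 0 ≤ a) (hab : a ≤ b) {z : X} {η : ℝ}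
    (hη : ∀ s ∈ Set.Icc a b, ‖U s y - z‖ ≤ η) :
    ‖U b x - U a x - (b - a) • z‖ ≤ η * (b - a) := by
  have h1 : ∀ s ∈ Set.Ico a b,
      HasDerivWithinAt (fun t => U t x - t • z) (U s y - z) (Set.Ici s) s := fun s hs => by
    have h2 := (hU.hasDerivWithinAt_orbit hxy (ha.trans hs.1)).sub
      ((hasDerivWithinAt_id s (Set.Ici s)).smul_const z)
    rwa [one_smul] at h2
  have hc : ContinuousOn (fun t => U t x - t • z) (Set.Icc a b) :=
    ((hU.2.2 x).mono fun s hs => ha.trans hs.1).sub (by fun_prop)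
  have h3 := norm_image_sub_le_of_norm_deriv_right_le_segment hc h1
    (fun s hs => hη s ⟨hs.1, hs.2.le⟩) b ⟨hab, le_rfl⟩
  convert h3 using 2
  module

theorem dense_generator_domain [CompleteSpace X] (hU : IsC0Semigroup U) :
    Dense {x | ∃ y, (x, y) ∈ generatorGraph U} := by
  intro x
  set f : ℝ → X := fun s => U (max s 0) x with hf
  have hfc : Continuous f :=
    (hU.2.2 x).comp_continuous (by fun_prop) fun s => le_max_right s 0
  set F : ℝ → X := fun u => ∫ s in (0 : ℝ)..u, f s with hF
  have hd : ∀ u, HasDerivAt F (f u) u := fun u =>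
    intervalIntegral.integral_hasDerivAt_right (hfc.intervalIntegrable _ _)
      (hfc.stronglyMeasurableAtFilter _ _) hfc.continuousAt
  have hF0 : F 0 = 0 := intervalIntegral.integral_same
  have hf0 : f 0 = x := by simp [hf, hU.1]
  have hslope : ∀ u, Tendsto (fun τ : ℝ => τ⁻¹ • (F (u + τ) - F u)) (𝓝[>] 0) (𝓝 (f u)) :=
    fun u => (hd u).tendsto_slope_zero_right
  have hshift : ∀ h, 0 ≤ h → ∀ τ, 0 ≤ τ → U τ (F h) = F (h + τ) - F τ := fun h hh τ hτ => by
    rw [hF]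
    simp only
    rw [← ContinuousLinearMap.intervalIntegral_comp_comm _ (hfc.intervalIntegrable _ _),
      intervalIntegral.integral_interval_sub_left (hfc.intervalIntegrable _ _)
        (hfc.intervalIntegrable _ _)]
    have h1 := intervalIntegral.integral_comp_add_right (a := 0) (b := h) f τ
    rw [zero_add] at h1
    rw [← h1]
    refine intervalIntegral.integral_congr fun s hs => ?_
    rw [Set.uIcc_of_le hh] at hs
    simp only [hf, max_eq_left hs.1, max_eq_left (add_nonneg hs.1 hτ)]
    rw [← mul_apply_eq_comp, ← hU.2.1 _ _ hτ hs.1, add_comm]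
  have hmem : ∀ h : ℝ, 0 < h → h⁻¹ • F h ∈ {x | ∃ y, (x, y) ∈ generatorGraph U} := by
    intro h hh
    refine ⟨h⁻¹ • (f h - f 0), ?_⟩
    refine (((hslope h).sub (hslope 0)).const_smul h⁻¹).congr' ?_
    filter_upwards [self_mem_nhdsWithin] with τ hτ
    have hτ : 0 < τ := hτ
    rw [ContinuousLinearMap.map_smul_of_tower, hshift h hh.le τ hτ.le, hF0, zero_add, sub_zero,
      ← Complex.ofReal_inv, Complex.coe_smul]
    module
  refine mem_closure_of_tendsto (f := fun h : ℝ => h⁻¹ • F h) (b := 𝓝[>] (0 : ℝ)) ?_ ?_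
  · have h1 := hslope 0
    rw [hf0] at h1
    simpa only [zero_add, hF0, sub_zero] using h1
  · filter_upwards [self_mem_nhdsWithin] with h hh using hmem h hh

end IsC0Semigroup

/-! ### Piecewise linear interpolation -/

/-- The hat function on `[-1, 1]` with peak value `1` at the origin. -/
noncomputable def hat (σ : ℝ) : ℝ := max 0 (1 - |σ|)

/-- The ramp rising from `0` to `1` on `[0, 1]`. -/
noncomputable def ramp (σ : ℝ) : ℝ := max 0 (min 1 σ)

theorem hat_nonneg (σ : ℝ) : 0 ≤ hat σ := le_max_left _ _

theorem abs_lt_one_of_hat_ne_zero {σ : ℝ} (h : hat σ ≠ 0) : |σ| < 1 := by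
  by_contra! h1
  exact h (max_eq_left (by linarith))

theorem hat_sub_one (σ : ℝ) : hat (σ - 1) = ramp σ - ramp (σ - 1) := by
  unfold hat ramp
  grind

theorem hat_eq_one_sub_ramp {σ : ℝ} (hσ : 0 ≤ σ) : hat σ = 1 - ramp σ := by
  unfold hat ramp
  grind

theorem ramp_mono : Monotone ramp := fun _ _ h =>
  max_le_max le_rfl (min_le_min le_rfl h)

theorem ramp_eq_zero {σ : ℝ} (hσ : σ ≤ 0) : ramp σ = 0 :=
  max_eq_left ((min_le_right _ _).trans hσ)

theorem ramp_eq_one {σ : ℝ} (hσ : 1 ≤ σ) : ramp σ = 1 := by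
  simp [ramp, min_eq_left hσ]

theorem sum_ramp (L : ℕ) {σ : ℝ} (hσ : 0 ≤ σ) (hL : σ ≤ L) :
    ∑ j ∈ Finset.range L, ramp (σ - j) = σ := by
  suffices h : ∑ j ∈ Finset.range L, ramp (σ - j) = min (L : ℝ) σ by rw [h, min_eq_right hL]
  clear hL
  induction L with
  | zero => simp [hσ]
  | succ L ih =>
    rw [Finset.sum_range_succ, ih, ramp]
    push_cast
    grind

theorem sum_hat_smul {E : Type*} [AddCommGroup E] [Module ℝ E] (g : ℕ → E) (L : ℕ) {σ : ℝ}
    (hσ : 0 ≤ σ) :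
    ∑ j ∈ Finset.range (L + 1), hat (σ - j) • g j =
      g 0 + ∑ j ∈ Finset.range L, ramp (σ - j) • (g (j + 1) - g j) - ramp (σ - L) • g L := by
  induction L with
  | zero =>
    simp [hat_eq_one_sub_ramp hσ, sub_smul]
  | succ L ih =>
    rw [Finset.sum_range_succ, ih, Finset.sum_range_succ]
    have h := hat_sub_one (σ - L)
    push_cast
    rw [← sub_sub, h]
    module

theorem sum_hat (L : ℕ) {σ : ℝ} (hσ : 0 ≤ σ) (hL : σ ≤ L) :
    ∑ j ∈ Finset.range (L + 1), hat (σ - j) = 1 := by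
  have h := sum_hat_smul (fun _ => (1 : ℝ)) L hσ
  simpa [ramp_eq_zero (sub_nonpos.2 hL)] using h

/-- Weighted averages of points close to `z` are close to `z`. -/
theorem norm_sum_smul_sub_le {E κ : Type*} [NormedAddCommGroup E] [NormedSpace ℝ E]
    {s : Finset κ} {w : κ → ℝ} {g : κ → E} {c η : ℝ} {z : E} (hw : ∀ j ∈ s, 0 ≤ w j)
    (hsum : ∑ j ∈ s, w j = c) (h : ∀ j ∈ s, w j ≠ 0 → ‖g j - z‖ ≤ η) :
    ‖∑ j ∈ s, w j • g j - c • z‖ ≤ c * η := by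
  rw [← hsum, Finset.sum_smul, Finset.sum_mul, ← Finset.sum_sub_distrib]
  refine norm_sum_le_of_le _ fun j hj => ?_
  rw [← smul_sub, norm_smul, Real.norm_of_nonneg (hw j hj)]
  by_cases h0 : w j = 0
  · simp [h0]
  · exact mul_le_mul_of_nonneg_left (h j hj h0) (hw j hj)

/-- Orbits in the domain of the generator are approximated by curves that are convex combinations
of finitely many points of a core. -/
theorem IsC0Semigroup.exists_interpolation {X : Type*} [NormedAddCommGroup X] [NormedSpace ℂ X]
    {U : ℝ → X →L[ℂ] X} (hU : IsC0Semigroup U) {S : Set (X × X)}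
    (hS : generatorGraph U ⊆ closure S) {x y : X} (hxy : (x, y) ∈ generatorGraph U)
    {T η : ℝ} (hT : 0 < T) (hη : 0 < η) :
    ∃ (L : ℕ) (p : ℕ → X × X) (ψ : ℕ → ℝ → ℝ) (δ : ℝ), 0 < δ ∧ (∀ j, p j ∈ S) ∧
      (∀ j s, 0 ≤ ψ j s) ∧ (∀ s ∈ Set.Icc 0 T, ∑ j ∈ Finset.range L, ψ j s = 1) ∧
      (∀ s ∈ Set.Icc 0 T, ‖∑ j ∈ Finset.range L, ψ j s • (p j).1 - U s x‖ ≤ η) ∧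
      (∀ s ∈ Set.Icc 0 T, ‖∑ j ∈ Finset.range L, ψ j s • (p j).2 - U s y‖ ≤ η) ∧
      ∀ a ∈ Set.Icc 0 T, ∀ b ∈ Set.Icc 0 T, a ≤ b → b - a ≤ δ →
        ‖∑ j ∈ Finset.range L, ψ j b • (p j).1 - ∑ j ∈ Finset.range L, ψ j a • (p j).1
          - (b - a) • U a y‖ ≤ (b - a) * η := by
  have huc : ∀ z, ∃ δ > 0, ∀ a ∈ Set.Icc 0 T, ∀ b ∈ Set.Icc 0 T, |a - b| < δ →
      ‖U a z - U b z‖ ≤ η / 2 := fun z => by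
    have h1 := isCompact_Icc.uniformContinuousOn_of_continuous
      ((hU.2.2 z).mono (Set.Icc_subset_Ici_self : Set.Icc 0 T ⊆ _))
    obtain ⟨δ, hδ, h2⟩ := Metric.uniformContinuousOn_iff.1 h1 (η / 2) (by positivity)
    exact ⟨δ, hδ, fun a ha b hb hab => by
      rw [← dist_eq_norm]; exact (h2 a ha b hb hab).le⟩
  obtain ⟨δ₁, hδ₁, hx⟩ := huc x
  obtain ⟨δ₂, hδ₂, hy⟩ := huc y
  obtain ⟨L, hL⟩ := exists_nat_gt (2 * T / min δ₁ δ₂)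
  have hδ : 0 < min δ₁ δ₂ := lt_min hδ₁ hδ₂
  have hL0 : (0 : ℝ) < L := lt_of_le_of_lt (by positivity) hL
  set Δ := T / L with hΔdef
  have hΔ : 0 < Δ := by positivity
  have hTL : T / Δ = L := by rw [hΔdef]; field_simp
  have hLΔ : L * Δ = T := by rw [hΔdef]; field_simp
  have hΔδ : 2 * Δ < min δ₁ δ₂ := by
    rw [div_lt_iff₀ hδ] at hL
    rw [hΔdef, ← mul_div_assoc, div_lt_iff₀ hL0]
    linarith
  have hΔ1 : 2 * Δ < δ₁ := hΔδ.trans_le (min_le_left _ _)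
  have hΔ2 : 2 * Δ < δ₂ := hΔδ.trans_le (min_le_right _ _)
  have hnode : ∀ j : ℕ, 0 ≤ j * Δ := fun j => by positivity
  have hnodeT : ∀ j : ℕ, j ≤ L → j * Δ ∈ Set.Icc 0 T := fun j hj => by
    refine ⟨hnode j, ?_⟩
    rw [← hLΔ]
    have : (j : ℝ) ≤ L := by exact_mod_cast hj
    gcongr
  have hp : ∀ j : ℕ, ∃ p ∈ S, ‖p.1 - U (j * Δ) x‖ ≤ min (η / 2) (Δ * (η / 4)) ∧
      ‖p.2 - U (j * Δ) y‖ ≤ η / 2 := fun j => by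
    have hε : 0 < min (η / 2) (Δ * (η / 4)) := by positivity
    obtain ⟨p, hp, hd⟩ := Metric.mem_closure_iff.1
      (hS (hU.orbit_mem_generatorGraph hxy (hnode j))) _ hε
    rw [dist_comm, Prod.dist_eq, max_lt_iff, dist_eq_norm, dist_eq_norm] at hd
    exact ⟨p, hp, hd.1.le, hd.2.le.trans (min_le_left _ _)⟩
  choose p hpS hp1 hp2 using hp
  have hsupp : ∀ s (j : ℕ), hat (s / Δ - j) ≠ 0 → |(j : ℝ) * Δ - s| < Δ := fun s j h => by
    have h1 := abs_lt_one_of_hat_ne_zero h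
    rw [abs_lt] at h1 ⊢
    have h2 : s = s / Δ * Δ := by field_simp
    constructor <;> nlinarith
  have hdiv : ∀ s ∈ Set.Icc 0 T, 0 ≤ s / Δ ∧ s / Δ ≤ L := fun s hs =>
    ⟨div_nonneg hs.1 hΔ.le, by rw [← hTL]; exact div_le_div_of_nonneg_right hs.2 hΔ.le⟩
  have hclose : ∀ (g : ℕ → X) (z : X), (∀ j, ‖g j - U (j * Δ) z‖ ≤ η / 2) →
      (∀ a ∈ Set.Icc 0 T, ∀ b ∈ Set.Icc 0 T, |a - b| < Δ → ‖U a z - U b z‖ ≤ η / 2) →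
      ∀ s ∈ Set.Icc 0 T,
        ‖∑ j ∈ Finset.range (L + 1), hat (s / Δ - j) • g j - U s z‖ ≤ η := by
    intro g z hg hz s hs
    have h1 := norm_sum_smul_sub_le (s := Finset.range (L + 1)) (w := fun j => hat (s / Δ - j))
      (g := g) (η := η) (z := U s z) (fun j _ => hat_nonneg _)
      (sum_hat L (hdiv s hs).1 (hdiv s hs).2) fun j hj h0 => by
        have h2 := hz _ (hnodeT j (Finset.mem_range_succ_iff.1 hj)) s hs (hsupp s j h0)
        linarith [norm_sub_le_norm_sub_add_norm_sub (g j) (U (j * Δ) z) (U s z), hg j]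
    simpa using h1
  refine ⟨L + 1, p, fun j s => hat (s / Δ - j), Δ, hΔ, hpS, fun j s => hat_nonneg _,
    fun s hs => sum_hat L (hdiv s hs).1 (hdiv s hs).2,
    hclose _ x (fun j => (hp1 j).trans (min_le_left _ _))
      fun a ha b hb hab => hx a ha b hb (by linarith),
    hclose _ y hp2 fun a ha b hb hab => hy a ha b hb (by linarith), ?_⟩
  intro a ha b hb hab hbaΔ
  have h1 : ∑ j ∈ Finset.range L, (ramp (b / Δ - j) - ramp (a / Δ - j)) = (b - a) / Δ := by
    rw [Finset.sum_sub_distrib, sum_ramp L (hdiv b hb).1 (hdiv b hb).2,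
      sum_ramp L (hdiv a ha).1 (hdiv a ha).2, sub_div]
  have h2 := norm_sum_smul_sub_le (s := Finset.range L)
    (w := fun j => ramp (b / Δ - j) - ramp (a / Δ - j))
    (g := fun j => (p (j + 1)).1 - (p j).1) (η := Δ * η) (z := Δ • U a y)
    (fun j _ => sub_nonneg.2 (ramp_mono (by gcongr))) h1 fun j hj h0 => by
      have hjL : j + 1 ≤ L := Finset.mem_range.1 hj
      have hja : a < (j + 1) * Δ := by
        by_contra! h
        have h3 : 1 ≤ a / Δ - j := by
          rw [le_sub_iff_add_le, le_div_iff₀ hΔ]; linarith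
        have h4 : a / Δ ≤ b / Δ := by gcongr
        exact h0 (by rw [ramp_eq_one h3, ramp_eq_one (by linarith), sub_self])
      have hjb : j * Δ < b := by
        by_contra! h
        have h3 : b / Δ - j ≤ 0 := by
          rw [sub_nonpos, div_le_iff₀ hΔ]; exact h
        have h4 : a / Δ ≤ b / Δ := by gcongr
        exact h0 (by rw [ramp_eq_zero h3, ramp_eq_zero (by linarith), sub_self])
      have hj1 := hnodeT (j + 1) hjL
      push_cast at hj1
      have h5 := hU.norm_orbit_sub_le hxy (hnode j) (b := (j + 1) * Δ) (by linarith)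
        (z := U a y) (η := η / 2) fun s hs =>
          hy s ⟨(hnode j).trans hs.1, hs.2.trans hj1.2⟩ a ha (by
            have := hs.1
            have := hs.2
            rw [abs_lt]; constructor <;> linarith)
      have h6 := (hp1 (j + 1)).trans (min_le_right _ _)
      have h7 := (hp1 j).trans (min_le_right _ _)
      push_cast at h6
      have e : (p (j + 1)).1 - (p j).1 - Δ • U a y =
          ((p (j + 1)).1 - U ((j + 1) * Δ) x) - ((p j).1 - U (j * Δ) x) +
            (U ((j + 1) * Δ) x - U (j * Δ) x - (((j + 1) * Δ - j * Δ)) • U a y) := by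
        rw [show ((j : ℝ) + 1) * Δ - j * Δ = Δ by ring]
        abel
      rw [e]
      have h8 := norm_add_le (((p (j + 1)).1 - U ((j + 1) * Δ) x) - ((p j).1 - U (j * Δ) x))
        (U ((j + 1) * Δ) x - U (j * Δ) x - (((j + 1) * Δ - j * Δ)) • U a y)
      have h9 := norm_sub_le ((p (j + 1)).1 - U ((j + 1) * Δ) x) ((p j).1 - U (j * Δ) x)
      rw [show ((j : ℝ) + 1) * Δ - j * Δ = Δ by ring] at h5 h8 ⊢
      linarith
  rw [sum_hat_smul (fun j => (p j).1) L (hdiv b hb).1,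
    sum_hat_smul (fun j => (p j).1) L (hdiv a ha).1,
    ramp_eq_zero (sub_nonpos.2 (hdiv b hb).2), ramp_eq_zero (sub_nonpos.2 (hdiv a ha).2)]
  simp only [sub_smul, Finset.sum_sub_distrib, smul_smul] at h2
  rw [show (b - a) / Δ * (Δ * η) = (b - a) * η by field_simp] at h2
  rw [div_mul_cancel₀ _ hΔ.ne'] at h2
  convert h2 using 2
  simp only [sub_smul]
  abel

/-! ### Convergence of stable and consistent discretizations -/

theorem norm_pow_apply_sub_le {Y : Type*} [NormedAddCommGroup Y] [NormedSpace ℂ Y]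
    {F : Y →L[ℂ] Y} {v : ℕ → Y} {n : ℕ} {C ε : ℝ} (hF : ∀ k ≤ n, ‖F ^ k‖ ≤ C)
    (hv : ∀ k < n, ‖F (v k) - v (k + 1)‖ ≤ ε) :
    ‖(F ^ n) (v 0) - v n‖ ≤ n * (C * ε) := by
  suffices h : ∀ j ≤ n, ‖(F ^ n) (v 0) - (F ^ (n - j)) (v j)‖ ≤ j * (C * ε) by
    simpa using h n le_rfl
  intro j
  induction j with
  | zero => simp
  | succ j ih =>
    intro hj
    have h1 := ih (by omega)
    have h2 : (F ^ (n - j)) (v j) = (F ^ (n - (j + 1))) (F (v j)) := by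
      rw [← mul_apply_eq_comp, ← pow_succ]
      congr 2
      omega
    have h3 : ‖(F ^ (n - (j + 1))) (F (v j) - v (j + 1))‖ ≤ C * ε :=
      (ContinuousLinearMap.le_of_opNorm_le _ (hF _ (by omega)) _).trans
        (mul_le_mul_of_nonneg_left (hv j (by omega))
          ((norm_nonneg _).trans (hF _ (Nat.zero_le n))))
    rw [map_sub, ← h2] at h3
    have h4 := norm_sub_le_norm_sub_add_norm_sub ((F ^ n) (v 0)) ((F ^ (n - j)) (v j))
      ((F ^ (n - (j + 1))) (v (j + 1)))
    rw [Nat.cast_succ]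
    linarith

section Convergence

variable {X : Type*} [NormedAddCommGroup X] [NormedSpace ℂ X]
  {Xm : ℕ → Type*} [∀ m, NormedAddCommGroup (Xm m)] [∀ m, NormedSpace ℂ (Xm m)]
  {P : ∀ m, X →L[ℂ] Xm m} {J : ∀ m, Xm m →L[ℂ] X} {K : ℝ}
  {U : ℝ → X →L[ℂ] X} {S : Set (X × X)} {F : ∀ m, ℝ → Xm m →L[ℂ] Xm m} {M ω : ℝ}

theorem norm_pow_le_of_growth_bound (hM : 0 ≤ M)
    (hF : ∀ h : ℝ, 0 < h → ∀ k m : ℕ, ‖F m h ^ k‖ ≤ M * Real.exp (k * h * ω))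
    {h T : ℝ} (hh : 0 < h) {k : ℕ} (hkT : k * h ≤ T) (m : ℕ) :
    ‖F m h ^ k‖ ≤ M * Real.exp (T * |ω|) := by
  refine (hF h hh k m).trans ?_
  have h0 : 0 ≤ k * h := by positivity
  refine mul_le_mul_of_nonneg_left (Real.exp_le_exp.2 ?_) hM
  exact (mul_le_mul_of_nonneg_left (le_abs_self ω) h0).trans (by gcongr)

theorem convergence_on_generator_domain (hJP : ∀ x : X, Tendsto (fun m => J m (P m x)) atTop (𝓝 x))
    (hJ : ∀ m, ‖J m‖ ≤ K) (hP : ∀ m, ‖P m‖ ≤ K) (hU : IsC0Semigroup U)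
    (hS : generatorGraph U ⊆ closure S)
    (hcons : ∀ p ∈ S, IsNull discretizationFilter fun q : ℕ × ℝ =>
      (q.2 : ℂ)⁻¹ • (F q.1 q.2 (P q.1 p.1) - P q.1 p.1) - P q.1 p.2)
    (hM : 0 ≤ M)
    (hF : ∀ h : ℝ, 0 < h → ∀ k m : ℕ, ‖F m h ^ k‖ ≤ M * Real.exp (k * h * ω))
    {x y : X} (hxy : (x, y) ∈ generatorGraph U) {T : ℝ} (hT : 0 < T) {ε : ℝ} (hε : 0 < ε) :
    ∃ N : ℕ, ∀ m ≥ N, ∀ n ≥ N, ∀ t : ℝ, 0 < t → t ≤ T →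
      ‖J m ((F m (t / n) ^ n) (P m x)) - U t x‖ ≤ ε := by
  have hK : 0 ≤ K := (norm_nonneg _).trans (hJ 0)
  set C := M * Real.exp (T * |ω|) with hCdef
  have hC : 0 ≤ C := by positivity
  set D := K * (C * K) + K * (T * C * (1 + 2 * K)) + 2 with hD
  have hDpos : 0 < D := by positivity
  set η := ε / D with hηdef
  have hη : 0 < η := by positivity
  obtain ⟨L, p, ψ, δ, hδ, hpS, hψ, hψsum, hd, hg, hinc⟩ :=
    hU.exists_interpolation hS hxy hT hη
  have hev : ∀ᶠ q : ℕ × ℝ in discretizationFilter, ∀ j ∈ Finset.range L,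
      ‖(q.2 : ℂ)⁻¹ • (F q.1 q.2 (P q.1 (p j).1) - P q.1 (p j).1) - P q.1 (p j).2‖ ≤ η :=
    (Finset.range L).eventually_all.2 fun j _ =>
      Tendsto.eventually_le_const hη (hcons _ (hpS j))
  obtain ⟨pa, hpa, pb, hpb, hab⟩ := eventually_prod_iff.1 hev
  obtain ⟨u, hu, hub⟩ := mem_nhdsGT_iff_exists_Ioo_subset.1 hpb
  have hu : 0 < u := hu
  have hev2 : ∀ᶠ m in atTop, ∀ j ∈ Finset.range L, ‖J m (P m (p j).1) - (p j).1‖ ≤ η :=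
    (Finset.range L).eventually_all.2 fun j _ =>
      Tendsto.eventually_le_const hη (tendsto_iff_norm_sub_tendsto_zero.1 (hJP (p j).1))
  obtain ⟨N₀, hN₀⟩ := eventually_atTop.1 (hpa.and hev2)
  obtain ⟨N₁, hN₁⟩ := exists_nat_gt (T / min u δ)
  refine ⟨max N₀ N₁, fun m hm n hn t ht htT => ?_⟩
  obtain ⟨hm1, hm2⟩ := hN₀ m (le_of_max_le_left hm)
  have hud : 0 < min u δ := lt_min hu hδ
  have hn1 : T / min u δ < n :=
    hN₁.trans_le (by exact_mod_cast le_of_max_le_right hn)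
  have hn0 : (0 : ℝ) < n := lt_of_le_of_lt (by positivity) hn1
  set h := t / n with hhdef
  have hh : 0 < h := by positivity
  have hnh : n * h = t := by rw [hhdef]; field_simp
  have hhlt : h < min u δ := by
    rw [div_lt_iff₀ hud] at hn1
    rw [hhdef, div_lt_iff₀ hn0]
    linarith
  have hloc : ∀ j ∈ Finset.range L,
      ‖F m h (P m (p j).1) - P m (p j).1 - h • P m (p j).2‖ ≤ h * η := fun j hj => by
    have h1 := hab hm1 (hub ⟨hh, hhlt.trans_le (min_le_left _ _)⟩) j hj
    simp only [← Complex.ofReal_inv, Complex.coe_smul] at h1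
    have e : F m h (P m (p j).1) - P m (p j).1 - h • P m (p j).2 =
        h • (h⁻¹ • (F m h (P m (p j).1) - P m (p j).1) - P m (p j).2) := by
      rw [smul_sub h (h⁻¹ • _), smul_inv_smul₀ hh.ne']
    rw [e, norm_smul, Real.norm_of_nonneg hh.le]
    exact mul_le_mul_of_nonneg_left h1 hh.le
  set d : ℝ → X := fun s => ∑ j ∈ Finset.range L, ψ j s • (p j).1 with hd_def
  set g : ℝ → X := fun s => ∑ j ∈ Finset.range L, ψ j s • (p j).2 with hg_def
  have htime : ∀ k ≤ n, (k : ℝ) * h ∈ Set.Icc 0 t := fun k hk => by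
    refine ⟨by positivity, ?_⟩
    rw [← hnh]
    have : (k : ℝ) ≤ n := by exact_mod_cast hk
    gcongr
  have hsub : Set.Icc 0 t ⊆ Set.Icc 0 T := Set.Icc_subset_Icc le_rfl htT
  have hstep : ∀ k < n, ‖F m h (P m (d (k * h))) - P m (d ((k + 1 : ℕ) * h))‖ ≤
      h * ((1 + 2 * K) * η) := fun k hk => by
    have hs := hsub (htime k hk.le)
    have hs' := hsub (htime (k + 1) hk)
    have hdiff : ((k + 1 : ℕ) : ℝ) * h - k * h = h := by push_cast; ring
    have e1 := norm_sum_smul_sub_le (s := Finset.range L) (w := fun j => ψ j (k * h))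
      (g := fun j => F m h (P m (p j).1) - P m (p j).1 - h • P m (p j).2) (z := 0)
      (fun j _ => hψ j _) (hψsum _ hs) (fun j hj _ => by rw [sub_zero]; exact hloc j hj)
    have e2 := (P m).le_of_opNorm_le_of_le (hP m) (hg _ hs)
    have e3 := hinc _ hs _ hs' (by linarith) (by
      rw [hdiff]; exact (hhlt.trans_le (min_le_right _ _)).le)
    rw [hdiff] at e3
    have e4 := (P m).le_of_opNorm_le_of_le (hP m) e3
    have e5 : F m h (P m (d (k * h))) - P m (d ((k + 1 : ℕ) * h)) =
        (∑ j ∈ Finset.range L, ψ j (k * h) •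
          (F m h (P m (p j).1) - P m (p j).1 - h • P m (p j).2) - (1 : ℝ) • 0) +
        h • P m (g (k * h) - U (k * h) y) -
        P m (d ((k + 1 : ℕ) * h) - d (k * h) - h • U (k * h) y) := by
      simp only [hd_def, hg_def, map_sub, map_sum, ContinuousLinearMap.map_smul_of_tower,
        smul_sub, Finset.sum_sub_distrib, Finset.smul_sum, smul_zero]
      simp only [smul_comm h]
      abel
    rw [e5]
    have e6 : ‖h • P m (g (k * h) - U (k * h) y)‖ ≤ h * (K * η) := by
      rw [norm_smul, Real.norm_of_nonneg hh.le]
      exact mul_le_mul_of_nonneg_left e2 hh.le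
    refine (norm_sub_le _ _).trans ((add_le_add ((norm_add_le _ _).trans
      (add_le_add e1 e6)) e4).trans (le_of_eq ?_))
    ring
  have hpow : ∀ k ≤ n, ‖F m h ^ k‖ ≤ C := fun k hk =>
    norm_pow_le_of_growth_bound hM hF hh (hsub (htime k hk)).2 m
  have f1 := norm_pow_apply_sub_le (v := fun k : ℕ => P m (d (k * h))) hpow hstep
  have f1' : (n : ℝ) * (C * (h * ((1 + 2 * K) * η))) ≤ T * C * (1 + 2 * K) * η := by
    calc (n : ℝ) * (C * (h * ((1 + 2 * K) * η))) = (n * h) * (C * (1 + 2 * K) * η) := by ring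
      _ ≤ T * (C * (1 + 2 * K) * η) := by rw [hnh]; gcongr
      _ = _ := by ring
  simp only [Nat.cast_zero, zero_mul, hnh] at f1
  have f2 := (J m).le_of_opNorm_le_of_le (hJ m) (f1.trans f1')
  have f3 := hd 0 ⟨le_rfl, hT.le⟩
  rw [hU.1, one_apply_eq_self, norm_sub_rev] at f3
  have f4 := (J m).le_of_opNorm_le_of_le (hJ m) ((F m h ^ n).le_of_opNorm_le_of_le
    (hpow n le_rfl) ((P m).le_of_opNorm_le_of_le (hP m) f3))
  have f5 := norm_sum_smul_sub_le (s := Finset.range L) (w := fun j => ψ j t)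
    (g := fun j => J m (P m (p j).1) - (p j).1) (z := 0) (fun j _ => hψ j _)
    (hψsum t ⟨ht.le, htT⟩) (fun j hj _ => by rw [sub_zero]; exact hm2 j hj)
  have f6 := hd t ⟨ht.le, htT⟩
  have e : J m ((F m h ^ n) (P m x)) - U t x =
      J m ((F m h ^ n) (P m (x - d 0))) + J m ((F m h ^ n) (P m (d 0)) - P m (d t)) +
      (∑ j ∈ Finset.range L, ψ j t • (J m (P m (p j).1) - (p j).1) - (1 : ℝ) • 0) +
      (d t - U t x) := by
    have e0 : ∑ j ∈ Finset.range L, ψ j t • (J m (P m (p j).1) - (p j).1) - (1 : ℝ) • (0 : X) =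
        J m (P m (d t)) - d t := by
      simp only [hd_def, map_sum, ContinuousLinearMap.map_smul_of_tower, smul_sub,
        Finset.sum_sub_distrib, smul_zero, sub_zero]
    rw [e0]
    simp only [map_sub]
    abel
  rw [e]
  refine (norm_add_le _ _).trans ((add_le_add ((norm_add_le _ _).trans (add_le_add
    ((norm_add_le _ _).trans (add_le_add f4 f2)) f5)) f6).trans (le_of_eq ?_))
  have hDη : D * η = ε := by rw [hηdef]; field_simp
  rw [← hDη, hD]
  ring

/-- A stable discretization that is consistent on a core of the generator converges to the
semigroup, uniformly on compact time intervals. -/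
theorem convergence_of_stable_consistent [CompleteSpace X]
    (hJP : ∀ x : X, Tendsto (fun m => J m (P m x)) atTop (𝓝 x))
    (hJ : ∀ m, ‖J m‖ ≤ K) (hP : ∀ m, ‖P m‖ ≤ K) (hU : IsC0Semigroup U)
    (hS : generatorGraph U ⊆ closure S)
    (hcons : ∀ p ∈ S, IsNull discretizationFilter fun q : ℕ × ℝ =>
      (q.2 : ℂ)⁻¹ • (F q.1 q.2 (P q.1 p.1) - P q.1 p.1) - P q.1 p.2)
    (hM : 0 ≤ M) (hF0 : ∀ m, F m 0 = 1)
    (hF : ∀ h : ℝ, 0 < h → ∀ k m : ℕ, ‖F m h ^ k‖ ≤ M * Real.exp (k * h * ω))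
    (x : X) (T : ℝ) {ε : ℝ} (hε : 0 < ε) :
    ∃ N : ℕ, ∀ m ≥ N, ∀ n ≥ N, ∀ t : ℝ, 0 ≤ t → t ≤ T →
      ‖J m ((F m (t / n) ^ n) (P m x)) - U t x‖ ≤ ε := by
  have hK : 0 ≤ K := (norm_nonneg _).trans (hJ 0)
  have hT : 0 < max T 1 := lt_max_of_lt_right one_pos
  obtain ⟨CU, hCU⟩ := hU.exists_norm_le (max T 1)
  have hCU0 : 0 ≤ CU := (norm_nonneg _).trans (hCU 0 ⟨le_rfl, hT.le⟩)
  set C := M * Real.exp (max T 1 * |ω|) with hCdef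
  set D := K * (C * K) + CU + 1 with hD
  have hC : 0 ≤ C := by positivity
  have hDpos : 0 < D := by positivity
  obtain ⟨x', ⟨y, hxy⟩, hx'⟩ := Metric.mem_closure_iff.1 (hU.dense_generator_domain x)
    (ε / 2 / D) (by positivity)
  rw [dist_eq_norm] at hx'
  obtain ⟨N₀, hN₀⟩ := convergence_on_generator_domain hJP hJ hP hU hS hcons hM hF hxy hT
    (half_pos hε)
  obtain ⟨N₁, hN₁⟩ := Metric.tendsto_atTop.1 (hJP x) ε hε
  refine ⟨max (max N₀ N₁) 1, fun m hm n hn t ht htT => ?_⟩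
  rcases ht.eq_or_lt with rfl | ht
  · rw [zero_div, hF0, one_pow, hU.1, one_apply_eq_self, one_apply_eq_self, ← dist_eq_norm]
    exact (hN₁ m ((le_max_right _ _).trans (le_of_max_le_left hm))).le
  have htT' : t ≤ max T 1 := htT.trans (le_max_left _ _)
  have hn0 : (0 : ℝ) < n := by exact_mod_cast lt_of_lt_of_le one_pos (le_of_max_le_right hn)
  have hpow : ‖F m (t / n) ^ n‖ ≤ C :=
    norm_pow_le_of_growth_bound hM hF (by positivity) (by
      rw [mul_div_cancel₀ _ hn0.ne']; exact htT') m
  have e1 := hN₀ m ((le_max_left _ _).trans (le_of_max_le_left hm)) n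
    ((le_max_left _ _).trans (le_of_max_le_left hn)) t ht htT'
  have e2 := (J m).le_of_opNorm_le_of_le (hJ m) ((F m (t / n) ^ n).le_of_opNorm_le_of_le
    hpow ((P m).le_of_opNorm_le (hP m) (x - x')))
  have e3 := (U t).le_of_opNorm_le (hCU t ⟨ht.le, htT'⟩) (x - x')
  have e4 : ‖x - x'‖ * D ≤ ε / 2 := ((lt_div_iff₀ hDpos).1 hx').le
  have e : J m ((F m (t / n) ^ n) (P m x)) - U t x =
      J m ((F m (t / n) ^ n) (P m (x - x'))) +
      (J m ((F m (t / n) ^ n) (P m x')) - U t x') - U t (x - x') := by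
    simp only [map_sub]
    abel
  rw [e]
  refine (norm_sub_le _ _).trans ((add_le_add ((norm_add_le _ _).trans (add_le_add e2 e1))
    e3).trans ?_)
  rw [hD] at e4
  nlinarith [norm_nonneg (x - x')]

end Convergence

/-- Consistency of the weighted splitting of two consistent one-step methods. -/
theorem isNull_weighted_splitting {ι : Type*} {l : Filter ι} {E : ι → Type*}
    [∀ i, NormedAddCommGroup (E i)] [∀ i, NormedSpace ℂ (E i)] {R Q : ∀ i, E i →L[ℂ] E i}
    {CR CQ : ℝ} (hR : ∀ᶠ i in l, ‖R i‖ ≤ CR) (hQ : ∀ᶠ i in l, ‖Q i‖ ≤ CQ) {a : ι → ℂ}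
    {x y z : ∀ i, E i} (hRx : IsNull l fun i => (a i)⁻¹ • (R i (x i) - x i) - y i)
    (hQx : IsNull l fun i => (a i)⁻¹ • (Q i (x i) - x i) - z i)
    (hQy : IsNull l fun i => Q i (y i) - y i) (hRz : IsNull l fun i => R i (z i) - z i)
    (θ : ℂ) :
    IsNull l fun i =>
      (a i)⁻¹ • ((θ • (Q i * R i) + (1 - θ) • (R i * Q i)) (x i) - x i) - (y i + z i) := by
  refine (((((hRx.apply hQ).add hQy).add hQx).smul θ).add
    ((((hQx.apply hR).add hRz).add hRx).smul (1 - θ))).congr' (Eventually.of_forall fun i => ?_)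
  simp only [map_sub, map_smul, add_apply, smul_apply, mul_apply_eq_comp]
  module

/-- **Convergence of the weighted splitting with spatial and rational temporal
discretization.** For `Θ ∈ [0,1]`, under the stability bound
`‖[Θ q(h B m) r(h A m) + (1−Θ) r(h A m) q(h B m)]^k‖ ≤ M₁ e^{khω}`,
`J m [Θ q((t/n) B m) r((t/n) A m) + (1−Θ) r((t/n) A m) q((t/n) B m)]^n P m x → U(t) x`
as `m, n → ∞`, uniformly for `t` in compact intervals of `[0, ∞)`. -/
theorem weighted_splitting_convergence
    (X : Type*) [NormedAddCommGroup X] [NormedSpace ℂ X] [CompleteSpace X]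
    (Xm : ℕ → Type*) [∀ m, NormedAddCommGroup (Xm m)] [∀ m, NormedSpace ℂ (Xm m)]
    [∀ m, CompleteSpace (Xm m)]
    -- the approximation scheme
    (P : ∀ m, X →L[ℂ] Xm m) (J : ∀ m, Xm m →L[ℂ] X)
    (hPJ : ∀ m (y : Xm m), P m (J m y) = y)
    (hJP : ∀ x : X, Tendsto (fun m => J m (P m x)) atTop (𝓝 x))
    (K : ℝ) (hK : 0 < K) (hJnorm : ∀ m, ‖J m‖ ≤ K) (hPnorm : ∀ m, ‖P m‖ ≤ K)
    -- the operators `A, A m`: closed and densely defined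
    (A : X →ₗ.[ℂ] X) (hAclosed : IsClosed (A.graph : Set (X × X)))
    (hAdense : Dense (A.domain : Set X))
    (Am : ∀ m, Xm m →ₗ.[ℂ] Xm m)
    (hAmclosed : ∀ m, IsClosed ((Am m).graph : Set (Xm m × Xm m)))
    (hAmdense : ∀ m, Dense ((Am m).domain : Set (Xm m)))
    -- stability of the family `A, A m`
    (RA : ℂ → X →L[ℂ] X) (RAm : ∀ m, ℂ → Xm m →L[ℂ] Xm m) (MA : ℝ) (hMA : 0 ≤ MA)
    (hRA : ∀ lam : ℂ, 0 < lam.re → IsResolvent A lam (RA lam) ∧ lam.re * ‖RA lam‖ ≤ MA)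
    (hRAm : ∀ m, ∀ lam : ℂ, 0 < lam.re →
      IsResolvent (Am m) lam (RAm m lam) ∧ lam.re * ‖RAm m lam‖ ≤ MA)
    -- consistency of the family `A, A m`
    (hPdomA : ∀ m, ∀ x ∈ A.domain, P m x ∈ (Am m).domain)
    (hconsA : ∀ x : A.domain,
      Tendsto (fun m => J m ((Am m) ⟨P m (x : X), hPdomA m x x.2⟩)) atTop (𝓝 (A x)))
    -- the operators `B, B m`: closed and densely defined
    (B : X →ₗ.[ℂ] X) (hBclosed : IsClosed (B.graph : Set (X × X)))
    (hBdense : Dense (B.domain : Set X))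
    (Bm : ∀ m, Xm m →ₗ.[ℂ] Xm m)
    (hBmclosed : ∀ m, IsClosed ((Bm m).graph : Set (Xm m × Xm m)))
    (hBmdense : ∀ m, Dense ((Bm m).domain : Set (Xm m)))
    -- stability of the family `B, B m`
    (RB : ℂ → X →L[ℂ] X) (RBm : ∀ m, ℂ → Xm m →L[ℂ] Xm m) (MB : ℝ) (hMB : 0 ≤ MB)
    (hRB : ∀ lam : ℂ, 0 < lam.re → IsResolvent B lam (RB lam) ∧ lam.re * ‖RB lam‖ ≤ MB)
    (hRBm : ∀ m, ∀ lam : ℂ, 0 < lam.re →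
      IsResolvent (Bm m) lam (RBm m lam) ∧ lam.re * ‖RBm m lam‖ ≤ MB)
    -- consistency of the family `B, B m`
    (hPdomB : ∀ m, ∀ x ∈ B.domain, P m x ∈ (Bm m).domain)
    (hconsB : ∀ x : B.domain,
      Tendsto (fun m => J m ((Bm m) ⟨P m (x : X), hPdomB m x x.2⟩)) atTop (𝓝 (B x)))
    -- the rational function `r`, via its partial fraction decomposition
    (lr : ℕ) (νr : Fin lr → ℕ) (hνr : ∀ i, 1 ≤ νr i) (lamr : Fin lr → ℂ)
    (Cr : Fin lr → ℕ → ℂ) (hlamr : ∀ i, 0 < (lamr i).re)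
    (hr0 : pfdFun lr νr lamr Cr 0 = 1)
    (hr1 : HasDerivAt (pfdFun lr νr lamr Cr) 1 0)
    (hrbdd : ∃ Cb : ℝ, ∀ z : ℂ, z.re ≤ 0 → ‖pfdFun lr νr lamr Cr z‖ ≤ Cb)
    -- the rational function `q`, via its partial fraction decomposition
    (lq : ℕ) (νq : Fin lq → ℕ) (hνq : ∀ i, 1 ≤ νq i) (lamq : Fin lq → ℂ)
    (Cq : Fin lq → ℕ → ℂ) (hlamq : ∀ i, 0 < (lamq i).re)
    (hq0 : pfdFun lq νq lamq Cq 0 = 1)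
    (hq1 : HasDerivAt (pfdFun lq νq lamq Cq) 1 0)
    (hqbdd : ∃ Cb : ℝ, ∀ z : ℂ, z.re ≤ 0 → ‖pfdFun lq νq lamq Cq z‖ ≤ Cb)
    -- `A` and `B` generate strongly continuous semigroups on `X`
    (TA : ℝ → X →L[ℂ] X) (hTA : IsGenerator A TA)
    (TB : ℝ → X →L[ℂ] X) (hTB : IsGenerator B TB)
    -- the closure of `A + B` (defined on `D(A) ∩ D(B)`) generates the semigroup `U`
    (U : ℝ → X →L[ℂ] X) (hU : IsC0Semigroup U)
    (hgen : closure {p : X × X | ∃ (hA : p.1 ∈ A.domain) (hB : p.1 ∈ B.domain),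
        A ⟨p.1, hA⟩ + B ⟨p.1, hB⟩ = p.2} = generatorGraph U)
    -- the weight and the stability bound
    (Θ : ℝ) (hΘ0 : 0 ≤ Θ) (hΘ1 : Θ ≤ 1)
    (M₁ : ℝ) (hM₁ : 1 ≤ M₁) (ω : ℝ)
    (hstab : ∀ h : ℝ, 0 < h → ∀ k m : ℕ,
      ‖((Θ : ℂ) • (ratOp lq νq lamq Cq (RBm m) h * ratOp lr νr lamr Cr (RAm m) h)
          + ((1 : ℂ) - (Θ : ℂ)) •
            (ratOp lr νr lamr Cr (RAm m) h * ratOp lq νq lamq Cq (RBm m) h)) ^ k‖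
        ≤ M₁ * Real.exp (k * h * ω))
 :
    ∀ x : X, ∀ t₀ : ℝ, 0 ≤ t₀ → ∀ ε > (0 : ℝ), ∃ N : ℕ, ∀ m ≥ N, ∀ n ≥ N,
      ∀ t : ℝ, 0 ≤ t → t ≤ t₀ →
        ‖J m ((((Θ : ℂ) • (ratOp lq νq lamq Cq (RBm m) (t / n)
              * ratOp lr νr lamr Cr (RAm m) (t / n))
            + ((1 : ℂ) - (Θ : ℂ)) • (ratOp lr νr lamr Cr (RAm m) (t / n)
              * ratOp lq νq lamq Cq (RBm m) (t / n))) ^ n) (P m x)) - U t x‖ ≤ ε := by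
  have hRb : ∀ᶠ p : ℕ × ℝ in discretizationFilter, ‖ratOp lr νr lamr Cr (RAm p.1) p.2‖ ≤ _ :=
    eventually_pos_discretizationFilter.mono fun p hp =>
      norm_ratOp_le (fun μ hμ => (hRAm p.1 μ hμ).2) lr νr hlamr Cr hp
  have hQb : ∀ᶠ p : ℕ × ℝ in discretizationFilter, ‖ratOp lq νq lamq Cq (RBm p.1) p.2‖ ≤ _ :=
    eventually_pos_discretizationFilter.mono fun p hp =>
      norm_ratOp_le (fun μ hμ => (hRBm p.1 μ hμ).2) lq νq hlamq Cq hp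
  intro x t₀ _ ε hε
  refine convergence_of_stable_consistent (F := fun m h =>
    (Θ : ℂ) • (ratOp lq νq lamq Cq (RBm m) h * ratOp lr νr lamr Cr (RAm m) h)
      + ((1 : ℂ) - (Θ : ℂ)) • (ratOp lr νr lamr Cr (RAm m) h * ratOp lq νq lamq Cq (RBm m) h))
    hJP hJnorm hPnorm hU hgen.ge ?_ (zero_le_one.trans hM₁) (fun m => ?_) hstab x t₀ hε
  · rintro p ⟨hA, hB, hAB⟩
    have h := isNull_weighted_splitting hRb hQb
      (isNull_ratOp_quotient_sub hPJ hPnorm hAdense hRAm hPdomA hconsA hlamr hr0 hr1 ⟨p.1, hA⟩)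
      (isNull_ratOp_quotient_sub hPJ hPnorm hBdense hRBm hPdomB hconsB hlamq hq0 hq1 ⟨p.1, hB⟩)
      (isNull_ratOp_sub hPJ hPnorm hBdense hRBm hPdomB hconsB hlamq hq0 _)
      (isNull_ratOp_sub hPJ hPnorm hAdense hRAm hPdomA hconsA hlamr hr0 _) (Θ : ℂ)
    simpa only [← map_add, hAB] using h
  · simp only [ratOp, le_refl, if_true, mul_one]
    module
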